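/- arXiv:1609.05675 — 2 statements merged into one kernel-verified Lean document; each statement's English description precedes it below -/
import Mathlib

section
/- Let T be a finite tree of order n and let k ≥ 3 be an integer with k < rad(T). Then γ_{B_k}(T) ≤ ⌈ ((k+2)/(k+1)) · (n/3) ⌉. -/
/-- `f` is a dominating `k`-broadcast on `G`: each value is at most `k`, and every
vertex `u` is `f`-dominated by some vertex `v` with `f v ≥ 1` and `d(u,v) ≤ f v`. -/
def IsDomKBroadcast {V : Type*} (G : SimpleGraph V) (k : ℕ) (f : V → ℕ) : Prop :=
  (∀ v, f v ≤ k) ∧ ∀ u, ∃ v, 1 ≤ f v ∧ G.Reachable u v ∧ G.dist u v ≤ f v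

/-- The dominating `k`-broadcast number: minimum cost of a dominating `k`-broadcast. -/
noncomputable def gammaBk {V : Type*} (G : SimpleGraph V) (k : ℕ) : ℕ :=
  sInf {c : ℕ | ∃ f : V → ℕ, IsDomKBroadcast G k f ∧ ∑ᶠ v, f v = c}

/-- The radius of a graph: the minimum eccentricity of a vertex. -/
noncomputable def grad {V : Type*} (G : SimpleGraph V) : ℕ :=
  sInf {e : ℕ | ∃ v : V, ∀ u : V, G.dist v u ≤ e}

/-- A leaf is a vertex of degree one, i.e. with a unique neighbor. -/
def IsLeaf {V : Type*} (G : SimpleGraph V) (u : V) : Prop := ∃! w, G.Adj u w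

/-- The number of admissible sizes `n ≤ m`: those with `n % 3 ≠ 0`, and `n % 3 = 1` if `k < n`. -/
def admissibleCount (k m : ℕ) : ℕ :=
  if m ≤ k then m - m / 3 else k - k / 3 + ((m + 2) / 3 - (k + 2) / 3)

/-- The subtree sizes that do not allow an immediate reduction. -/
def Admissible (k m : ℕ) : Prop := m % 3 ≠ 0 ∧ (k < m → m % 3 = 1)

theorem admissibleCount_lt {k m m' : ℕ} (h : m < m') (h' : Admissible k m') :
    admissibleCount k m + 1 ≤ admissibleCount k m' := by
  obtain ⟨h3, h4⟩ := h'
  unfold admissibleCount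
  rcases Nat.lt_or_ge k m' with hk | hk
  · have := h4 hk
    rw [if_neg (by omega : ¬ m' ≤ k)]
    split_ifs <;> omega
  · rw [if_pos hk, if_pos (by omega)]
    omega

theorem admissibleCount_le {k m : ℕ} (h : m ≤ 2 * k + 1) : admissibleCount k m ≤ k + 1 := by
  unfold admissibleCount
  split_ifs <;> omega

theorem le_of_lt_admissibleCount {k m : ℕ} (h : k + 1 ≤ admissibleCount k m) : 2 * k ≤ m := by
  unfold admissibleCount at h
  split_ifs at h <;> omega

theorem admissibleCount_branch {k m m₁ m₂ j : ℕ} (hk : 3 ≤ k) (h : m₁ + m₂ + 1 ≤ m)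
    (hm : Admissible k m) (hm₁ : Admissible k m₁) (hj : 1 ≤ j)
    (h₁ : j ≤ admissibleCount k m₁) (h₂ : j ≤ admissibleCount k m₂) :
    j + 2 ≤ admissibleCount k m := by
  have c0 : admissibleCount k 0 = 0 := by simp [admissibleCount]
  have c1 : admissibleCount k 1 = 1 := by rw [admissibleCount, if_pos (by omega)]
  have c2 : admissibleCount k 2 = 2 := by rw [admissibleCount, if_pos (by omega)]
  have c3 : admissibleCount k 3 = 2 := by rw [admissibleCount, if_pos (by omega)]
  have small : ∀ n, n = 0 ∨ n = 1 ∨ n = 2 ∨ n = 3 ∨ 4 ≤ n := by omega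
  have c4 := admissibleCount_lt (k := k) (m := 2) (m' := 4) (by omega) ⟨by omega, by omega⟩
  have h3 := hm.1
  have h3' := hm₁.1
  by_cases hj3 : 3 ≤ j
  · have : 4 ≤ m₂ := by
      rcases small m₂ with h | h | h | h | h <;> first | omega | (subst h; omega)
    obtain ⟨p, hp1, hp2, hp3⟩ : ∃ p, m₁ < p ∧ p < m ∧ p % 3 = 1 := by
      by_cases h : m₁ % 3 = 1
      · exact ⟨m₁ + 3, by omega, by omega, by omega⟩
      · exact ⟨m₁ + 2, by omega, by omega, by omega⟩
    have := admissibleCount_lt (k := k) hp1 ⟨by omega, fun _ => hp3⟩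
    have := admissibleCount_lt hp2 hm
    omega
  · have hm1 : j ≤ m₁ := by
      rcases small m₁ with h | h | h | h | h <;> first | omega | (subst h; omega)
    have hm2 : j ≤ m₂ := by
      rcases small m₂ with h | h | h | h | h <;> first | omega | (subst h; omega)
    by_cases hj1 : j = 1
    · have := admissibleCount_lt (k := k) (m := 2) (m' := m) (by omega) hm
      omega
    · have := admissibleCount_lt (k := k) (m := 4) (m' := m) (by omega) hm
      omega

theorem cost_le_of_size {k p m : ℕ} (hk : 3 ≤ k) (h₁ : 3 * k + 1 ≤ m) (h₂ : 2 * k * p + 1 ≤ m) :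
    3 * (k + 1) * (k + p) ≤ (k + 2) * m := by
  rcases Nat.lt_or_ge p 2 with h | h
  · interval_cases p <;> nlinarith
  · obtain ⟨q, rfl⟩ := Nat.exists_eq_add_of_le h
    refine le_trans ?_ (Nat.mul_le_mul_left (k + 2) h₂)
    nlinarith [Nat.zero_le (k * q), Nat.zero_le (k * k * q), mul_le_mul hk hk,
      Nat.mul_le_mul_right (k * q) hk, Nat.mul_le_mul_right q hk]

/-- A rooted spanning tree of `G`, given by its parent and depth functions. -/
structure RootedSpanning {V : Type*} (G : SimpleGraph V) where
  root : V
  par : V → V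
  dep : V → ℕ
  dep_par : ∀ v, dep (par v) = dep v - 1
  eq_root : ∀ v, dep v = 0 → v = root
  dep_root : dep root = 0
  dist_par : ∀ v, G.dist v (par v) ≤ 1

namespace RootedSpanning

open Finset

variable {V : Type*} {G : SimpleGraph V}

theorem exists_of_connected (hG : G.Connected) : Nonempty (RootedSpanning G) := by
  classical
  obtain ⟨r⟩ := hG.nonempty
  have key : ∀ v, ∃ w, G.dist r w = G.dist r v - 1 ∧ G.dist v w ≤ 1 := by
    intro v
    obtain ⟨p, hp⟩ := hG.exists_walk_length_eq_dist v r
    cases p with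
    | nil => exact ⟨r, by simp, by simp⟩
    | @cons _ w _ h q =>
      have h1 : G.dist v w = 1 := SimpleGraph.dist_eq_one_iff_adj.2 h
      have h2 := SimpleGraph.dist_le q
      have h3 := hG.dist_triangle (u := v) (v := w) (w := r)
      rw [SimpleGraph.Walk.length_cons] at hp
      refine ⟨w, ?_, h1.le⟩
      rw [SimpleGraph.dist_comm (u := r) (v := w), SimpleGraph.dist_comm (u := r) (v := v)]
      omega
  choose f hf using key
  exact ⟨⟨r, f, fun v => G.dist r v, fun v => (hf v).1,
    fun v hv => ((hG.dist_eq_zero_iff).1 hv).symm, by simp, fun v => (hf v).2⟩⟩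

/-- Every vertex of `S` hears the broadcast `f`. -/
def Dominates (G : SimpleGraph V) (f : V → ℕ) (S : Finset V) : Prop :=
  ∀ u ∈ S, ∃ v, 1 ≤ f v ∧ G.dist u v ≤ f v

theorem Dominates.mono {f g : V → ℕ} {S : Finset V} (h : Dominates G f S) (hfg : f ≤ g) :
    Dominates G g S := fun u hu => by
  obtain ⟨v, h1, h2⟩ := h u hu
  exact ⟨v, h1.trans (hfg v), h2.trans (hfg v)⟩

theorem sum_sup_le [Fintype V] (f g : V → ℕ) : ∑ v, (f ⊔ g) v ≤ ∑ v, f v + ∑ v, g v := by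
  rw [← Finset.sum_add_distrib]
  exact Finset.sum_le_sum fun v _ => by simp

variable (P : RootedSpanning G)

theorem dep_iterate (j : ℕ) (v : V) : P.dep (P.par^[j] v) = P.dep v - j := by
  induction j with
  | zero => simp
  | succ j ih => rw [Function.iterate_succ_apply', P.dep_par, ih]; omega

theorem dist_iterate (hG : G.Connected) (j : ℕ) (v : V) : G.dist v (P.par^[j] v) ≤ j := by
  induction j with
  | zero => simp
  | succ j ih =>
    rw [Function.iterate_succ_apply']
    have h1 := hG.dist_triangle (u := v) (v := P.par^[j] v) (w := P.par (P.par^[j] v))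
    have h2 := P.dist_par (P.par^[j] v)
    omega

/-- A set of vertices closed under taking parents. -/
def Closed (S : Finset V) : Prop := ∀ u ∈ S, P.par u ∈ S

variable {P} in
theorem Closed.iterate {S : Finset V} (hS : P.Closed S) {u : V} (hu : u ∈ S) (j : ℕ) :
    P.par^[j] u ∈ S := by
  induction j with
  | zero => exact hu
  | succ j ih => rw [Function.iterate_succ_apply']; exact hS _ ih

variable {P} in
theorem Closed.root_mem {S : Finset V} (hS : P.Closed S) {u : V} (hu : u ∈ S) : P.root ∈ S := by
  have : P.par^[P.dep u] u = P.root := P.eq_root _ (by rw [P.dep_iterate]; omega)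
  rw [← this]
  exact hS.iterate hu _

variable [DecidableEq V]

/-- The vertices of `S` that are descendants of `y`, including `y` itself. -/
def sub (S : Finset V) (y : V) : Finset V :=
  S.filter fun u => P.dep y ≤ P.dep u ∧ P.par^[P.dep u - P.dep y] u = y

variable {P} {S : Finset V} {u v w y z : V}

theorem mem_sub : u ∈ P.sub S y ↔
    u ∈ S ∧ P.dep y ≤ P.dep u ∧ P.par^[P.dep u - P.dep y] u = y := by
  simp [sub]

theorem self_mem_sub (hy : y ∈ S) : y ∈ P.sub S y := by
  simp [mem_sub, hy]

theorem mem_sub_iterate (hu : u ∈ S) {j : ℕ} (hj : j ≤ P.dep u) :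
    u ∈ P.sub S (P.par^[j] u) := by
  rw [mem_sub, P.dep_iterate]
  exact ⟨hu, by omega, by rw [Nat.sub_sub_self hj]⟩

theorem iterate_mem_sub (hS : P.Closed S) (hu : u ∈ P.sub S y) {j : ℕ}
    (hj : j ≤ P.dep u - P.dep y) : P.par^[j] u ∈ P.sub S y := by
  obtain ⟨h1, h2, h3⟩ := mem_sub.1 hu
  rw [mem_sub, P.dep_iterate]
  refine ⟨hS.iterate h1 j, by omega, ?_⟩
  rw [← Function.iterate_add_apply, ← h3]
  congr 2
  rw [h3]
  omega

theorem sub_subset (h : y ∈ P.sub S z) : P.sub S y ⊆ P.sub S z := by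
  intro u hu
  obtain ⟨h1, h2, h3⟩ := mem_sub.1 hu
  obtain ⟨h4, h5, h6⟩ := mem_sub.1 h
  refine mem_sub.2 ⟨h1, by omega, ?_⟩
  have : P.dep u - P.dep z = (P.dep y - P.dep z) + (P.dep u - P.dep y) := by omega
  rw [this, Function.iterate_add_apply, h3, h6]

theorem dep_lt (h : y ∈ P.sub S z) (hne : y ≠ z) : P.dep z < P.dep y := by
  obtain ⟨-, h5, h6⟩ := mem_sub.1 h
  refine lt_of_le_of_ne h5 fun h => hne ?_
  rw [h, Nat.sub_self] at h6
  exact h6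

theorem sub_disjoint (hd : P.dep y = P.dep z) (hne : y ≠ z) :
    Disjoint (P.sub S y) (P.sub S z) := by
  rw [Finset.disjoint_left]
  intro u h1 h2
  have h3 := (mem_sub.1 h1).2.2
  have h4 := (mem_sub.1 h2).2.2
  rw [hd] at h3
  exact hne (h3.symm.trans h4)

theorem notMem_sub_of_dep_lt (h : P.dep z < P.dep y) : z ∉ P.sub S y := fun hz => by
  have := (mem_sub.1 hz).2.1
  omega

theorem card_sub_lt (h : y ∈ P.sub S z) (hz : z ∈ S) (hne : y ≠ z) :
    (P.sub S y).card < (P.sub S z).card :=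
  Finset.card_lt_card <| (Finset.ssubset_iff_of_subset (sub_subset h)).2
    ⟨z, self_mem_sub hz, notMem_sub_of_dep_lt (dep_lt h hne)⟩

theorem Closed.sdiff (hS : P.Closed S) (y : V) : P.Closed (S \ P.sub S y) := by
  intro u hu
  rw [Finset.mem_sdiff] at hu ⊢
  refine ⟨hS u hu.1, fun h => hu.2 ?_⟩
  obtain ⟨-, h2, h3⟩ := mem_sub.1 h
  rcases Nat.eq_zero_or_pos (P.dep u) with h0 | h0
  · have h4 : P.par u = u := by
      rw [P.eq_root u h0]
      exact P.eq_root _ (by rw [P.dep_par, P.dep_root])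
    rwa [h4] at h
  · rw [P.dep_par] at h2 h3
    refine mem_sub.2 ⟨hu.1, by omega, ?_⟩
    rw [← Function.iterate_succ_apply] at h3
    rwa [show P.dep u - P.dep y = (P.dep u - 1 - P.dep y).succ by omega]

theorem sub_sdiff : P.sub (S \ P.sub S y) z = P.sub S z \ P.sub S y := by
  ext u
  simp only [mem_sub, Finset.mem_sdiff]
  tauto

theorem sub_root : P.sub S P.root = S := by
  ext u
  rw [mem_sub, P.dep_root]
  refine ⟨fun h => h.1, fun h => ⟨h, Nat.zero_le _, P.eq_root _ ?_⟩⟩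
  rw [P.dep_iterate]
  omega

/-- Walking up from `b`, a function that increases strictly at the admissible subtree sizes
increases by at least one at each step. -/
theorem chain {A : ℕ → Prop} {φ : ℕ → ℕ} (hφ : ∀ m m', m < m' → A m' → φ m + 1 ≤ φ m')
    (hS : P.Closed S) (hu : u ∈ S) {j : ℕ} (hj : j ≤ P.dep u)
    (hA : ∀ i, 1 ≤ i → i ≤ j → A (P.sub S (P.par^[i] u)).card) :
    φ (P.sub S u).card + j ≤ φ (P.sub S (P.par^[j] u)).card := by
  induction j with
  | zero => simp
  | succ j ih =>
    have h1 := ih (by omega) fun i h1 h2 => hA i h1 (by omega)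
    have h2 : (P.sub S (P.par^[j] u)).card < (P.sub S (P.par^[j + 1] u)).card := by
      have hd : P.dep (P.par^[j + 1] u) < P.dep (P.par^[j] u) := by
        rw [P.dep_iterate, P.dep_iterate]; omega
      refine card_sub_lt ?_ (hS.iterate hu _) fun h => ?_
      · rw [Function.iterate_succ_apply']
        exact mem_sub_iterate (j := 1) (hS.iterate hu _) (by rw [P.dep_iterate]; omega)
      · rw [h] at hd; omega
    have h3 := hφ _ _ h2 (hA (j + 1) (by omega) le_rfl)
    omega

/-- Two distinct vertices of equal depth whose parents agree contribute disjoint subtrees. -/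
theorem card_sub_add_card_sub_lt (hS : P.Closed S) (hv : v ∈ S) (hw : w ∈ S) (hne : v ≠ w)
    (hpar : P.par v = P.par w) (hd : P.dep v = P.dep w) :
    (P.sub S v).card + (P.sub S w).card + 1 ≤ (P.sub S (P.par v)).card := by
  have hpos : 0 < P.dep v := by
    by_contra h
    exact hne ((P.eq_root v (by omega)).trans (P.eq_root w (by omega)).symm)
  have hdp : P.dep (P.par v) < P.dep v := by rw [P.dep_par]; omega
  have h1 : v ∈ P.sub S (P.par v) := mem_sub_iterate (j := 1) hv hpos
  have h2 : w ∈ P.sub S (P.par v) := hpar ▸ mem_sub_iterate (j := 1) hw (by omega)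
  have h3 : P.sub S v ∪ P.sub S w ⊆ (P.sub S (P.par v)).erase (P.par v) := by
    intro u hu
    rw [Finset.mem_erase]
    rcases Finset.mem_union.1 hu with h | h
    · refine ⟨?_, sub_subset h1 h⟩
      rintro rfl
      exact notMem_sub_of_dep_lt hdp h
    · refine ⟨?_, sub_subset h2 h⟩
      rintro rfl
      exact notMem_sub_of_dep_lt (hd ▸ hdp) h
  have h4 := Finset.card_le_card h3
  rw [Finset.card_union_of_disjoint (sub_disjoint hd hne),
    Finset.card_erase_of_mem (self_mem_sub (hS v hv))] at h4
  have h5 := Finset.card_pos.2 ⟨_, self_mem_sub (P := P) (hS v hv)⟩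
  omega

theorem dist_le_of_mem_sub (hG : G.Connected) (h : u ∈ P.sub S y) :
    G.dist u y ≤ P.dep u - P.dep y := by
  have := P.dist_iterate hG (P.dep u - P.dep y) u
  rwa [(mem_sub.1 h).2.2] at this

/-- If no proper subtree has size divisible by three, the whole subtree has small radius. -/
theorem exists_center (hG : G.Connected) (hS : P.Closed S) (hz : z ∈ S)
    (h3 : ∀ w ∈ P.sub S z, w ≠ z → (P.sub S w).card % 3 ≠ 0) :
    ∃ c R, 1 ≤ R ∧ (∀ u ∈ P.sub S z, G.dist u c ≤ R) ∧ 3 * R ≤ (P.sub S z).card + 2 := by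
  obtain ⟨u, hu, hmax⟩ := Finset.exists_max_image (P.sub S z) P.dep ⟨z, self_mem_sub hz⟩
  obtain ⟨huS, hzu, huz⟩ := mem_sub.1 hu
  have size : ∀ v ∈ P.sub S z, ∀ j, P.dep z + j < P.dep v →
      j + 1 ≤ (2 * (P.sub S (P.par^[j] v)).card + 2) / 3 := by
    intro v hv j hj
    have hvS := (mem_sub.1 hv).1
    have := chain (P := P) (S := S) (u := v) (j := j) (A := fun m => m % 3 ≠ 0)
      (φ := fun m => (2 * m + 2) / 3) (fun m m' h h' => by
        have : m' % 3 = 1 ∨ m' % 3 = 2 := by omega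
        rcases this with h | h <;> omega) hS hvS
      (by omega) fun i hi hij => by
        refine h3 _ (iterate_mem_sub hS hv (by omega)) fun h => ?_
        have := P.dep_iterate i v
        rw [h] at this
        omega
    have h1 := Finset.card_pos.2 ⟨_, self_mem_sub (P := P) hvS⟩
    omega
  have lca : ∀ w ∈ P.sub S z, ∃ i ≤ P.dep u - P.dep z, w ∈ P.sub S (P.par^[i] u) ∧
      ∀ j < i, w ∉ P.sub S (P.par^[j] u) := by
    intro w hw
    have hex : ∃ i, w ∈ P.sub S (P.par^[i] u) := ⟨P.dep u - P.dep z, by rwa [huz]⟩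
    exact ⟨Nat.find hex, Nat.find_min' hex (by rwa [huz]), Nat.find_spec hex,
      fun j hj => Nat.find_min hex hj⟩
  choose! i hi hmem hmin using lca
  obtain ⟨w, hw, hwmax⟩ := Finset.exists_max_image (P.sub S z)
    (fun w => P.dep w + 2 * i w - P.dep u) ⟨z, self_mem_sub hz⟩
  have hdw := (mem_sub.1 (hmem w hw)).2.1
  rw [P.dep_iterate] at hdw
  have hiw := hi w hw
  have hmw := hmax w hw
  obtain ⟨d, hd⟩ : ∃ d, d = P.dep w + 2 * i w - P.dep u := ⟨_, rfl⟩
  refine ⟨P.par^[(d + 1) / 2] u, max ((d + 1) / 2) 1, le_max_right _ _, ?_, ?_⟩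
  · intro x hx
    refine le_trans ?_ (le_max_left _ _)
    have hxmax := hwmax x hx
    have hxu := hmax x hx
    have hix := hi x hx
    have hdx := (mem_sub.1 (hmem x hx)).2.1
    have hdist := dist_le_of_mem_sub hG (hmem x hx)
    have htri := hG.dist_triangle (u := x) (v := P.par^[i x] u) (w := P.par^[(d + 1) / 2] u)
    rw [P.dep_iterate] at hdx hdist
    rcases le_total (i x) ((d + 1) / 2) with h | h
    · obtain ⟨e, he⟩ := Nat.exists_eq_add_of_le' h
      have h1 := P.dist_iterate hG e (P.par^[i x] u)
      rw [← Function.iterate_add_apply, ← he] at h1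
      omega
    · obtain ⟨e, he⟩ := Nat.exists_eq_add_of_le' h
      have h1 := P.dist_iterate hG e (P.par^[(d + 1) / 2] u)
      rw [← Function.iterate_add_apply, ← he, SimpleGraph.dist_comm] at h1
      omega
  · have hpos := Finset.card_pos.2 ⟨_, self_mem_sub (P := P) hz⟩
    rcases Nat.eq_zero_or_pos d with hd0 | hd0
    · rw [max_eq_right (by omega)]
      omega
    have hi1 : 1 ≤ i w := by omega
    obtain ⟨e, he⟩ := Nat.exists_eq_add_of_le' hi1
    have s1 := size u hu e (by omega)
    have hpu : P.par (P.par^[e] u) = P.par^[i w] u := by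
      rw [← Function.iterate_succ_apply' P.par, he]
    have htop : P.par^[i w] u ∈ P.sub S z := iterate_mem_sub hS hu hiw
    have hle := Finset.card_le_card (sub_subset htop)
    have hde : P.dep (P.par^[e] u) = P.dep u - e := P.dep_iterate _ _
    have hdi : P.dep (P.par^[i w] u) = P.dep u - i w := P.dep_iterate _ _
    rw [max_eq_left (by omega)]
    by_cases ht : P.dep w + i w = P.dep u
    · have : (P.sub S (P.par^[e] u)).card < (P.sub S (P.par^[i w] u)).card := by
        refine card_sub_lt ?_ (hS.iterate huS _) fun h => ?_
        · rw [← hpu]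
          exact mem_sub_iterate (j := 1) (hS.iterate huS _) (by omega)
        · rw [h] at hde
          omega
      omega
    · obtain ⟨t, ht'⟩ : ∃ t, t + 1 = P.dep w + i w - P.dep u := ⟨_, Nat.sub_add_cancel (by omega)⟩
      have s2 := size w hw t (by omega)
      have hwS := (mem_sub.1 hw).1
      have hpw : P.par (P.par^[t] w) = P.par^[i w] u := by
        rw [← Function.iterate_succ_apply' P.par, ← (mem_sub.1 (hmem w hw)).2.2, hdi]
        congr 1
        omega
      have hdt : P.dep (P.par^[t] w) = P.dep w - t := P.dep_iterate _ _
      have := card_sub_add_card_sub_lt hS (hS.iterate huS e) (hS.iterate hwS t)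
        (fun h => hmin w hw e (by omega) (h ▸ mem_sub_iterate hwS (by omega)))
        (hpu.trans hpw.symm) (by omega)
      rw [hpu] at this
      omega

theorem Dominates.sup {f g : V → ℕ} {S S' : Finset V} (h : Dominates G f S')
    (h' : Dominates G g (S \ S')) : Dominates G (f ⊔ g) S := fun u hu => by
  by_cases hu' : u ∈ S'
  · exact h.mono le_sup_left u hu'
  · exact h'.mono le_sup_right u (Finset.mem_sdiff.2 ⟨hu, hu'⟩)

theorem dominates_single {c : V} {R : ℕ} (hR : 1 ≤ R) (h : ∀ u ∈ S, G.dist u c ≤ R) :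
    Dominates G (Pi.single c R) S := fun u hu => ⟨c, by simpa, by simpa using h u hu⟩

variable [Fintype V]

/-- A tree with `n` vertices has a dominating broadcast of cost at most `⌈n / 3⌉`. -/
theorem exists_broadcast (hG : G.Connected) : ∀ (n : ℕ) {S : Finset V} {z : V},
    P.Closed S → z ∈ S → (P.sub S z).card = n →
    ∃ f : V → ℕ, Dominates G f (P.sub S z) ∧ 3 * ∑ v, f v ≤ n + 2 := by
  intro n
  induction n using Nat.strong_induction_on with
  | _ n ih =>
    intro S z hS hz hn
    by_cases h3 : ∀ w ∈ P.sub S z, w ≠ z → (P.sub S w).card % 3 ≠ 0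
    · obtain ⟨c, R, hR, hdist, hcard⟩ := exists_center hG hS hz h3
      exact ⟨Pi.single c R, dominates_single hR hdist, by simp; omega⟩
    · push Not at h3
      obtain ⟨w, hw, hne, hmod⟩ := h3
      have hwS := (mem_sub.1 hw).1
      have hlt := card_sub_lt hw hz hne
      have hpos := Finset.card_pos.2 ⟨_, self_mem_sub (P := P) hwS⟩
      have hcard := Finset.card_sdiff_add_card_eq_card (sub_subset hw)
      obtain ⟨f, hf, hfc⟩ := ih _ (hn ▸ hlt) hS hwS rfl
      obtain ⟨g, hg, hgc⟩ := ih ((P.sub S z \ P.sub S w).card) (by omega) (hS.sdiff w)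
        (Finset.mem_sdiff.2 ⟨hz, notMem_sub_of_dep_lt (dep_lt hw hne)⟩) (by rw [sub_sdiff])
      rw [sub_sdiff] at hg
      have := sum_sup_le f g
      exact ⟨f ⊔ g, hf.sup hg, by omega⟩

/-- The subtree at `z` has a `k`-limited broadcast of cost at most `(k + 2) / (3 (k + 1))` times
its size. -/
def Reducible (P : RootedSpanning G) (k : ℕ) (S : Finset V) (z : V) : Prop :=
  ∃ f : V → ℕ, (∀ v, f v ≤ k) ∧ Dominates G f (P.sub S z) ∧
    3 * (k + 1) * ∑ v, f v ≤ (k + 2) * (P.sub S z).card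

theorem reducible_of_card_le {k : ℕ} (hG : G.Connected) (hS : P.Closed S) (hz : z ∈ S)
    (hle : (P.sub S z).card ≤ 3 * k)
    (hmod : Admissible k (P.sub S z).card → 2 * k + 2 ≤ (P.sub S z).card) :
    Reducible P k S z := by
  obtain ⟨f, hf, hfc⟩ := exists_broadcast hG _ hS hz rfl
  refine ⟨f, fun v => ?_, hf, ?_⟩
  · have := Finset.single_le_sum (f := f) (fun v _ => Nat.zero_le _) (Finset.mem_univ v)
    omega
  · generalize (P.sub S z).card = m at *
    generalize ∑ v, f v = s at *
    have key : 3 * s ≤ m ∨ (3 * s ≤ m + 1 ∧ k + 1 ≤ m) ∨ 2 * k + 2 ≤ m := by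
      unfold Admissible at hmod
      omega
    rcases key with h | h | h <;> nlinarith

theorem exists_reducible {k : ℕ} (hk : 3 ≤ k) (hG : G.Connected) (hS : P.Closed S) {x : V}
    (hx : x ∈ S) (hbig : 2 * k + 2 ≤ (P.sub S x).card)
    (hsmall : ∀ w ∈ P.sub S x, w ≠ x → (P.sub S w).card ≤ 2 * k + 1) :
    ∃ z ∈ S, Reducible P k S z := by
  by_contra! hno
  have hadm : ∀ w ∈ P.sub S x, w ≠ x → Admissible k (P.sub S w).card := by
    intro w hw hne
    by_contra h
    have := hsmall w hw hne
    exact hno w (mem_sub.1 hw).1 (reducible_of_card_le hG hS (mem_sub.1 hw).1 (by omega)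
      fun h' => absurd h' h)
  have hcard : 3 * k + 1 ≤ (P.sub S x).card := by
    by_contra h
    exact hno x hx (reducible_of_card_le hG hS hx (by omega) fun _ => hbig)
  have hanc : ∀ u ∈ P.sub S x, ∀ i, P.dep x + i < P.dep u →
      P.par^[i] u ∈ P.sub S x ∧ P.par^[i] u ≠ x := by
    intro u hu i hi
    refine ⟨iterate_mem_sub hS hu (by omega), fun h => ?_⟩
    have := P.dep_iterate i u
    rw [h] at this
    omega
  have hchain : ∀ u ∈ P.sub S x, ∀ i j, P.dep x + (i + j) < P.dep u →
      admissibleCount k (P.sub S (P.par^[i] u)).card + j ≤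
        admissibleCount k (P.sub S (P.par^[i + j] u)).card := by
    intro u hu i j hij
    have huS := (mem_sub.1 hu).1
    have := chain (P := P) (S := S) (u := P.par^[i] u) (j := j) (A := Admissible k)
      (φ := admissibleCount k) (fun m m' => admissibleCount_lt) hS (hS.iterate huS i)
      (by rw [P.dep_iterate]; omega) fun l _ hl => by
        rw [← Function.iterate_add_apply]
        have := hanc u hu (l + i) (by omega)
        exact hadm _ this.1 this.2
    rwa [← Function.iterate_add_apply, add_comm j i] at this
  have hone : ∀ u ∈ P.sub S x, P.dep x < P.dep u → 1 ≤ admissibleCount k (P.sub S u).card := by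
    intro u hu hlt
    have h0 := hanc u hu 0 (by omega)
    have := admissibleCount_lt (k := k)
      (Finset.card_pos.2 ⟨_, self_mem_sub (P := P) (mem_sub.1 hu).1⟩) (hadm u hu h0.2)
    omega
  have hcount : ∀ u ∈ P.sub S x, ∀ i, P.dep x + i < P.dep u →
      i + 1 ≤ admissibleCount k (P.sub S (P.par^[i] u)).card := by
    intro u hu i hi
    have h1 := hchain u hu 0 i (by omega)
    have h2 := hone u hu (by omega)
    rw [Nat.zero_add, Function.iterate_zero_apply] at h1
    omega
  have htop : ∀ u ∈ P.sub S x, ∀ i, P.dep x + i < P.dep u →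
      admissibleCount k (P.sub S (P.par^[i] u)).card ≤ k + 1 := fun u hu i hi =>
    admissibleCount_le (hsmall _ (hanc u hu i hi).1 (hanc u hu i hi).2)
  have hheight : ∀ u ∈ P.sub S x, P.dep u ≤ P.dep x + (k + 1) := by
    intro u hu
    by_contra h
    have h1 := hcount u hu (k + 1) (by omega)
    have h2 := htop u hu (k + 1) (by omega)
    omega
  obtain ⟨W, hW⟩ : ∃ W, W = (P.sub S x).filter fun u => P.dep u = P.dep x + (k + 1) := ⟨_, rfl⟩
  have hWmem : ∀ {u}, u ∈ W ↔ u ∈ P.sub S x ∧ P.dep u = P.dep x + (k + 1) := by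
    intro u
    rw [hW, Finset.mem_filter]
  have hinj : Set.InjOn (P.par^[k]) W := by
    intro u hu w hw huw
    by_contra hne
    obtain ⟨hu, hdu⟩ := hWmem.1 hu
    obtain ⟨hw, hdw⟩ := hWmem.1 hw
    have huS := (mem_sub.1 hu).1
    have hwS := (mem_sub.1 hw).1
    have hex : ∃ j, P.par^[j] u = P.par^[j] w := ⟨k, huw⟩
    obtain ⟨j, hj, hjmin⟩ : ∃ j, P.par^[j] u = P.par^[j] w ∧
        ∀ i < j, P.par^[i] u ≠ P.par^[i] w :=
      ⟨Nat.find hex, Nat.find_spec hex, fun i hi => Nat.find_min hex hi⟩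
    have hjk : j ≤ k := by
      by_contra h
      exact hjmin k (by omega) huw
    cases j with
    | zero => exact hne hj
    | succ i =>
      rw [Function.iterate_succ_apply', Function.iterate_succ_apply'] at hj
      have hlt := card_sub_add_card_sub_lt hS (hS.iterate huS i) (hS.iterate hwS i)
        (hjmin i (by omega)) hj (by rw [P.dep_iterate, P.dep_iterate, hdu, hdw])
      rw [← Function.iterate_succ_apply' P.par] at hlt
      change _ + _ + 1 ≤ (P.sub S (P.par^[i + 1] u)).card at hlt
      have hu1 := hanc u hu i (by omega)
      have hu2 := hanc u hu (i + 1) (by omega)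
      have h1 := admissibleCount_branch hk hlt (hadm _ hu2.1 hu2.2) (hadm _ hu1.1 hu1.2)
        (by omega) (hcount u hu i (by omega)) (hcount w hw i (by omega))
      obtain ⟨e, rfl⟩ := Nat.exists_eq_add_of_le hjk
      have h2 := hchain u hu (i + 1) e (by omega)
      have h3 := htop u hu (i + 1 + e) (by omega)
      omega
  have hsize : 2 * k * W.card + 1 ≤ (P.sub S x).card := by
    have hdep : ∀ u ∈ W, P.dep (P.par^[k] u) = P.dep x + 1 := by
      intro u hu
      rw [P.dep_iterate, (hWmem.1 hu).2]
      omega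
    have hsub : W.biUnion (fun u => P.sub S (P.par^[k] u)) ⊆ (P.sub S x).erase x := by
      intro v hv
      obtain ⟨u, hu, hv⟩ := Finset.mem_biUnion.1 hv
      have hd := (hWmem.1 hu).2
      have h1 := hdep u hu
      refine Finset.mem_erase.2 ⟨?_, sub_subset (hanc u (hWmem.1 hu).1 k (by omega)).1 hv⟩
      rintro rfl
      exact notMem_sub_of_dep_lt (by omega) hv
    have hle := Finset.card_le_card hsub
    rw [Finset.card_biUnion fun u hu w hw hne => sub_disjoint ((hdep u hu).trans (hdep w hw).symm)
      fun h => hne (hinj hu hw h), Finset.card_erase_of_mem (self_mem_sub hx)] at hle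
    have hmul : W.card * (2 * k) ≤ ∑ u ∈ W, (P.sub S (P.par^[k] u)).card := by
      refine Finset.card_nsmul_le_sum _ _ _ fun u hu => le_of_lt_admissibleCount ?_
      have hd := (hWmem.1 hu).2
      exact hcount u (hWmem.1 hu).1 k (by omega)
    rw [mul_comm]
    omega
  refine hno x hx ⟨Pi.single x k ⊔ (fun v => if v ∈ W then 1 else 0), fun v => ?_, ?_, ?_⟩
  · rw [Pi.sup_apply, sup_le_iff]
    refine ⟨?_, by split_ifs <;> omega⟩
    by_cases h : v = x
    · subst h; simp
    · simp [h]
  · refine Dominates.sup (S' := P.sub S x \ W) ?_ ?_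
    · refine dominates_single (by omega) fun u hu => ?_
      rw [Finset.mem_sdiff] at hu
      have h1 := dist_le_of_mem_sub hG hu.1
      have h2 := hheight u hu.1
      have h3 : P.dep u ≠ P.dep x + (k + 1) := fun h => hu.2 (hWmem.2 ⟨hu.1, h⟩)
      omega
    · intro u hu
      have hu : u ∈ W := by
        by_contra h
        rw [Finset.mem_sdiff, Finset.mem_sdiff] at hu
        exact hu.2 ⟨hu.1, h⟩
      exact ⟨u, by simp [hu], by simp⟩
  · refine le_trans (Nat.mul_le_mul_left _ ((sum_sup_le _ _).trans_eq ?_))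
      (cost_le_of_size hk hcard hsize)
    simp

theorem exists_limited_broadcast {k : ℕ} (hk : 3 ≤ k) (hG : G.Connected) :
    ∀ (n : ℕ) {S : Finset V}, P.Closed S → S.card = n →
    ∃ f : V → ℕ, (∀ v, f v ≤ k) ∧ Dominates G f S ∧
      3 * (k + 1) * ∑ v, f v < (k + 2) * n + 3 * (k + 1) := by
  intro n
  induction n using Nat.strong_induction_on with
  | _ n ih =>
    intro S hS hn
    rcases S.eq_empty_or_nonempty with rfl | ⟨s, hs⟩
    · exact ⟨0, by simp, fun u hu => by simp at hu, by simp⟩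
    have hroot := hS.root_mem hs
    by_cases hbig : n ≤ 2 * k + 1
    · obtain ⟨f, hf, hfc⟩ := exists_broadcast hG n hS hroot (by rw [sub_root, hn])
      rw [sub_root] at hf
      refine ⟨f, fun v => ?_, hf, ?_⟩
      · have := Finset.single_le_sum (f := f) (fun v _ => Nat.zero_le _) (Finset.mem_univ v)
        omega
      · nlinarith
    · obtain ⟨x, hx, hmax⟩ := Finset.exists_max_image
        (S.filter fun x => 2 * k + 2 ≤ (P.sub S x).card) P.dep
        ⟨P.root, Finset.mem_filter.2 ⟨hroot, by rw [sub_root]; omega⟩⟩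
      rw [Finset.mem_filter] at hx
      obtain ⟨z, hz, f, hfk, hf, hfc⟩ := exists_reducible hk hG hS hx.1 hx.2 fun w hw hne => by
        by_contra h
        have h1 := hmax w (Finset.mem_filter.2 ⟨(mem_sub.1 hw).1, by omega⟩)
        have h2 := dep_lt hw hne
        omega
      have hpos := Finset.card_pos.2 ⟨_, self_mem_sub (P := P) hz⟩
      have hcard : (S \ P.sub S z).card + (P.sub S z).card = S.card :=
        Finset.card_sdiff_add_card_eq_card (Finset.filter_subset _ S)
      obtain ⟨g, hgk, hg, hgc⟩ := ih ((S \ P.sub S z).card) (by omega) (hS.sdiff z) rfl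
      refine ⟨f ⊔ g, fun v => sup_le (hfk v) (hgk v), hf.sup hg, ?_⟩
      have h1 := Nat.mul_le_mul_left (3 * (k + 1)) (sum_sup_le f g)
      rw [← hn, ← hcard]
      linarith

end RootedSpanning

theorem gammaBk_tree_upper_bound {V : Type*} [Fintype V] (T : SimpleGraph V)
    (hT : T.IsTree) (k : ℕ) (hk : 3 ≤ k) (hrad : k < grad T) :
    (gammaBk T k : ℤ) ≤
      ⌈((k : ℚ) + 2) / ((k : ℚ) + 1) * ((Fintype.card V : ℚ) / 3)⌉ := by
  classical
  have hG := hT.connected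
  obtain ⟨P⟩ := RootedSpanning.exists_of_connected hG
  obtain ⟨f, hfk, hf, hfc⟩ := RootedSpanning.exists_limited_broadcast (P := P) hk hG
    (Fintype.card V) (S := Finset.univ) (fun _ _ => Finset.mem_univ _) rfl
  have hle : gammaBk T k ≤ ∑ v, f v := Nat.sInf_le ⟨f, ⟨hfk, fun u => by
    obtain ⟨v, h1, h2⟩ := hf u (Finset.mem_univ u)
    exact ⟨v, h1, hG.preconnected u v, h2⟩⟩, finsum_eq_sum_of_fintype f⟩
  refine (Int.ofNat_le.2 hle).trans ?_
  rw [Int.le_ceil_iff, div_mul_div_comm, lt_div_iff₀ (by positivity)]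
  have h : (3 * (k + 1) * (∑ v, f v : ℕ) : ℚ) < (k + 2) * Fintype.card V + 3 * (k + 1) := by
    exact_mod_cast hfc
  rw [Int.cast_natCast]
  linarith
end

section
/- Let G be a finite connected graph of order n and let k ≥ 3 be an integer. Then γ_{B_k}(G) ≤ ⌈ ((k+2)/(k+1)) · (n/3) ⌉. -/
/-- Rooted trees with vertices labelled by `V`: a single vertex, or a tree `t` to whose root
the root of another tree `s` has been attached as a child. -/
inductive GraftTree (V : Type*) where
  | single (v : V) : GraftTree V
  | graft (t s : GraftTree V) : GraftTree V

namespace GraftTree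

variable {V : Type*}

def root : GraftTree V → V
  | single v => v
  | graft t _ => t.root

def verts : GraftTree V → Set V
  | single v => {v}
  | graft t s => t.verts ∪ s.verts

def size : GraftTree V → ℕ
  | single _ => 1
  | graft t s => t.size + s.size

def height : GraftTree V → ℕ
  | single _ => 0
  | graft t s => max t.height (s.height + 1)

def diam : GraftTree V → ℕ
  | single _ => 0
  | graft t s => max (max t.diam s.diam) (t.height + s.height + 1)

/-- The vertices at depth `d` below the root. -/
def level : GraftTree V → ℕ → Set V
  | single v, 0 => {v}
  | single _, _ + 1 => ∅
  | graft t _, 0 => t.level 0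
  | graft t s, d + 1 => t.level (d + 1) ∪ s.level d

/-- All parent-child pairs are edges of `G`. -/
def Valid (G : SimpleGraph V) : GraftTree V → Prop
  | single _ => True
  | graft t s => t.Valid G ∧ s.Valid G ∧ G.Adj t.root s.root

/-- The subterm relation. -/
inductive Subterm (z : GraftTree V) : GraftTree V → Prop
  | refl : Subterm z z
  | left {t s : GraftTree V} : Subterm z t → Subterm z (graft t s)
  | right {t s : GraftTree V} : Subterm z s → Subterm z (graft t s)

theorem Subterm.trans {x y z : GraftTree V} (h₁ : Subterm x y) (h₂ : Subterm y z) :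
    Subterm x z := by
  induction h₂ with
  | refl => exact h₁
  | left _ ih => exact ih.left
  | right _ ih => exact ih.right

theorem Subterm.valid {G : SimpleGraph V} {z x : GraftTree V} (h : Subterm z x)
    (hx : x.Valid G) : z.Valid G := by
  induction h with
  | refl => exact hx
  | left _ ih => exact ih hx.1
  | right _ ih => exact ih hx.2.1

theorem size_pos (x : GraftTree V) : 1 ≤ x.size := by
  induction x with
  | single v => simp [size]
  | graft t s iht ihs => simp only [size]; omega

theorem height_lt_size (x : GraftTree V) : x.height + 1 ≤ x.size := by
  induction x with
  | single v => simp [size, height]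
  | graft t s iht ihs => simp only [size, height]; omega

theorem height_le_diam (x : GraftTree V) : x.height ≤ x.diam := by
  induction x with
  | single v => simp [diam, height]
  | graft t s iht ihs => simp only [diam, height]; omega

theorem Subterm.diam_le {z x : GraftTree V} (h : Subterm z x) : z.diam ≤ x.diam := by
  induction h with
  | refl => exact le_rfl
  | left _ ih => simp only [diam]; omega
  | right _ ih => simp only [diam]; omega

theorem exists_mem_level_of_mem_verts {x : GraftTree V} {u : V} (hu : u ∈ x.verts) :
    ∃ d ≤ x.height, u ∈ x.level d := by
  induction x with
  | single v => exact ⟨0, le_rfl, hu⟩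
  | graft t s iht ihs =>
    rcases hu with hu | hu
    · obtain ⟨d, hd, h⟩ := iht hu
      refine ⟨d, hd.trans (le_max_left _ _), ?_⟩
      cases d with
      | zero => exact h
      | succ d => exact Or.inl h
    · obtain ⟨d, hd, h⟩ := ihs hu
      exact ⟨d + 1, le_max_of_le_right (by omega), Or.inr h⟩

theorem level_eq_empty {x : GraftTree V} {d : ℕ} (hd : x.height < d) : x.level d = ∅ := by
  induction x generalizing d with
  | single v => cases d with
    | zero => simp [height] at hd
    | succ d => rfl
  | graft t s iht ihs =>
    simp only [height] at hd
    cases d with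
    | zero => omega
    | succ d => simp only [level]; rw [iht (by omega), ihs (by omega), Set.union_empty]

theorem level_graft_of_lt_left {t s : GraftTree V} (h : s.height + 1 < t.height) :
    (graft t s).level (graft t s).height = t.level t.height := by
  have e : (graft t s).height = t.height := by simp only [height]; omega
  rw [e]
  obtain ⟨d, hd⟩ : ∃ d, t.height = d + 1 := ⟨t.height - 1, by omega⟩
  rw [hd]; simp only [level]
  rw [level_eq_empty (x := s) (by omega), Set.union_empty]

theorem level_graft_of_lt_right {t s : GraftTree V} (h : t.height < s.height + 1) :
    (graft t s).level (graft t s).height = s.level s.height := by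
  have e : (graft t s).height = s.height + 1 := by simp only [height]; omega
  rw [e]; simp only [level]
  rw [level_eq_empty (x := t) h, Set.empty_union]

/-- A subterm may be replaced by any tree with the same root. -/
theorem Subterm.replace {G : SimpleGraph V} {z x z' : GraftTree V} (h : Subterm z x)
    (hx : x.Valid G) (hz' : z'.Valid G) (hr : z'.root = z.root) {Y : Set V}
    (hY : z.verts ⊆ z'.verts ∪ Y) :
    ∃ x' : GraftTree V, x'.Valid G ∧ x'.root = x.root ∧ x'.size + z.size = x.size + z'.size ∧
      x.verts ⊆ x'.verts ∪ Y := by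
  induction h with
  | refl => exact ⟨z', hz', hr, by omega, hY⟩
  | @left t s _ ih =>
    obtain ⟨t', h1, h2, h3, h4⟩ := ih hx.1
    refine ⟨graft t' s, ⟨h1, hx.2.1, h2 ▸ hx.2.2⟩, h2, by simp only [size]; omega, ?_⟩
    rintro u (hu | hu)
    · rcases h4 hu with h | h
      exacts [Or.inl (Or.inl h), Or.inr h]
    · exact Or.inl (Or.inr hu)
  | @right t s _ ih =>
    obtain ⟨s', h1, h2, h3, h4⟩ := ih hx.2.1
    refine ⟨graft t s', ⟨hx.1, h1, h2 ▸ hx.2.2⟩, rfl, by simp only [size]; omega, ?_⟩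
    rintro u (hu | hu)
    · exact Or.inl (Or.inl hu)
    · rcases h4 hu with h | h
      exacts [Or.inl (Or.inr h), Or.inr h]

/-- A tree of positive height has a child of maximal height, which can be removed. -/
theorem exists_child {G : SimpleGraph V} {z : GraftTree V} (hz : z.Valid G)
    (h : 1 ≤ z.height) :
    ∃ t a t' : GraftTree V, Subterm (graft t a) z ∧ a.height + 1 = z.height ∧
      G.Adj z.root a.root ∧ t'.Valid G ∧ t'.root = z.root ∧ t'.size + a.size = z.size ∧
      z.verts ⊆ t'.verts ∪ a.verts := by
  induction z with
  | single v => simp [height] at h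
  | graft t s iht ihs =>
    by_cases hts : t.height ≤ s.height
    · exact ⟨t, s, t, .refl, by simp only [height]; omega, hz.2.2, hz.1, rfl, rfl, subset_rfl⟩
    · obtain ⟨q, a, t', h1, h2, h3, h4, h5, h6, h7⟩ := iht hz.1 (by omega)
      refine ⟨q, a, graft t' s, h1.left, by simp only [height]; omega, h3,
        ⟨h4, hz.2.1, h5 ▸ hz.2.2⟩, h5, by simp only [size]; omega, ?_⟩
      rintro u (hu | hu)
      · rcases h7 hu with h | h
        exacts [Or.inl (Or.inl h), Or.inr h]
      · exact Or.inl (Or.inr hu)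

theorem dist_root_le_of_mem_level {G : SimpleGraph V} (hG : G.Connected) {x : GraftTree V}
    (hx : x.Valid G) {d : ℕ} {u : V} (hu : u ∈ x.level d) : G.dist x.root u ≤ d := by
  induction x generalizing d with
  | single v => cases d with
    | zero =>
      have : u = v := hu
      simp [root, this]
    | succ d => exact hu.elim
  | graft t s iht ihs =>
    cases d with
    | zero => exact iht hx.1 hu
    | succ d =>
      rcases hu with hu | hu
      · exact iht hx.1 hu
      · have h1 := ihs hx.2.1 hu
        have h2 := hG.dist_triangle (u := t.root) (v := s.root) (w := u)
        have h3 := SimpleGraph.dist_eq_one_iff_adj.2 hx.2.2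
        simp only [root]
        omega

theorem dist_root_le_height {G : SimpleGraph V} (hG : G.Connected) {x : GraftTree V}
    (hx : x.Valid G) {u : V} (hu : u ∈ x.verts) : G.dist x.root u ≤ x.height := by
  obtain ⟨d, hd, h⟩ := exists_mem_level_of_mem_verts hu
  exact (dist_root_le_of_mem_level hG hx h).trans hd

theorem exists_center {G : SimpleGraph V} (hG : G.Connected) {x : GraftTree V}
    (hx : x.Valid G) {r : ℕ} (hr : x.diam ≤ 2 * r) :
    ∃ c, G.dist c x.root ≤ x.height - r ∧ ∀ u ∈ x.verts, G.dist c u ≤ r := by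
  induction x with
  | single v =>
    refine ⟨v, by simp [root], fun u hu => ?_⟩
    have : u = v := hu
    simp [this]
  | graft t s iht ihs =>
    have hd := height_le_diam (graft t s)
    by_cases hh : (graft t s).height ≤ r
    · exact ⟨(graft t s).root, by simp, fun u hu => (dist_root_le_height hG hx hu).trans hh⟩
    have h1 := SimpleGraph.dist_eq_one_iff_adj.2 hx.2.2
    simp only [diam, height] at hd hh hr ⊢
    by_cases hts : s.height + 1 ≤ t.height
    · obtain ⟨c, hc, h⟩ := iht hx.1 (by omega)
      refine ⟨c, hc.trans (by omega), ?_⟩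
      rintro u (hu | hu)
      · exact h u hu
      · have h2 := dist_root_le_height hG hx.2.1 hu
        have h3 := hG.dist_triangle (u := c) (v := t.root) (w := u)
        have h4 := hG.dist_triangle (u := t.root) (v := s.root) (w := u)
        omega
    · obtain ⟨c, hc, h⟩ := ihs hx.2.1 (by omega)
      have h5 := hG.dist_triangle (u := c) (v := s.root) (w := t.root)
      rw [SimpleGraph.dist_comm (u := s.root)] at h5
      refine ⟨c, by simp only [root]; omega, ?_⟩
      rintro u (hu | hu)
      · have h2 := dist_root_le_height hG hx.1 hu
        have h3 := hG.dist_triangle (u := c) (v := t.root) (w := u)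
        omega
      · exact h u hu

theorem exists_insert {G : SimpleGraph V} {x : GraftTree V} (hx : x.Valid G) {u w : V}
    (hu : u ∈ x.verts) (huw : G.Adj u w) :
    ∃ x' : GraftTree V, x'.Valid G ∧ x'.root = x.root ∧ x'.size = x.size + 1 ∧
      x'.verts = insert w x.verts := by
  induction x with
  | single v =>
    obtain rfl : u = v := hu
    refine ⟨graft (single u) (single w), ⟨trivial, trivial, huw⟩, rfl, rfl, ?_⟩
    ext y; simp [verts, or_comm]
  | graft t s iht ihs =>
    rcases hu with hu | hu
    · obtain ⟨t', h1, h2, h3, h4⟩ := iht hx.1 hu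
      refine ⟨graft t' s, ⟨h1, hx.2.1, h2 ▸ hx.2.2⟩, h2, by simp only [size]; omega, ?_⟩
      simp only [verts, h4, Set.insert_union]
    · obtain ⟨s', h1, h2, h3, h4⟩ := ihs hx.2.1 hu
      refine ⟨graft t s', ⟨hx.1, h1, h2 ▸ hx.2.2⟩, rfl, by simp only [size]; omega, ?_⟩
      simp only [verts, h4, Set.union_insert]

theorem exists_spanning [Fintype V] {G : SimpleGraph V} (hG : G.Connected) :
    ∃ x : GraftTree V, x.Valid G ∧ x.size = Fintype.card V ∧ x.verts = Set.univ := by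
  have key : ∀ n, 1 ≤ n → n ≤ Fintype.card V →
      ∃ x : GraftTree V, x.Valid G ∧ x.size = n ∧ x.verts.ncard = n := by
    intro n hn
    induction n, hn using Nat.le_induction with
    | base =>
      intro _
      obtain ⟨v⟩ := hG.nonempty
      exact ⟨single v, trivial, rfl, by simp [verts]⟩
    | succ n hn ih =>
      intro hle
      obtain ⟨x, h1, h2, h3⟩ := ih (by omega)
      have hne : x.verts.Nonempty := Set.nonempty_of_ncard_ne_zero (by omega)
      obtain ⟨u, hu⟩ := hne
      have hex : ∃ w, w ∉ x.verts := by
        by_contra! hall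
        rw [Set.eq_univ_of_forall hall, Set.ncard_univ, Nat.card_eq_fintype_card] at h3
        omega
      obtain ⟨w, hw⟩ := hex
      obtain ⟨p⟩ := hG.preconnected u w
      obtain ⟨d, _, hd1, hd2⟩ := p.exists_boundary_dart x.verts hu hw
      obtain ⟨x', h4, _, h5, h6⟩ := exists_insert h1 hd1 d.adj
      refine ⟨x', h4, by omega, ?_⟩
      rw [h6, Set.ncard_insert_of_notMem hd2, h3]
  have := hG.nonempty
  obtain ⟨x, h1, h2, h3⟩ := key (Fintype.card V) Fintype.card_pos le_rfl
  refine ⟨x, h1, h2, Set.eq_of_subset_of_ncard_le (Set.subset_univ _) ?_⟩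
  rw [h3, Set.ncard_univ, Nat.card_eq_fintype_card]

end GraftTree

/-- The vertices of `Y` can be dominated by a `k`-limited broadcast of cost at most `w`. -/
def BroadcastCovers {V : Type*} [Fintype V] (G : SimpleGraph V) (k : ℕ) (Y : Set V)
    (w : ℕ) : Prop :=
  ∃ f : V → ℕ, (∀ v, f v ≤ k) ∧ (∀ u ∈ Y, ∃ v, 1 ≤ f v ∧ G.dist u v ≤ f v) ∧ ∑ v, f v ≤ w

namespace BroadcastCovers

variable {V : Type*} [Fintype V] {G : SimpleGraph V} {k : ℕ}

theorem mono {Y Z : Set V} {w w' : ℕ} (h : BroadcastCovers G k Y w) (hZ : Z ⊆ Y)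
    (hw : w ≤ w') : BroadcastCovers G k Z w' := by
  obtain ⟨f, h1, h2, h3⟩ := h
  exact ⟨f, h1, fun u hu => h2 u (hZ hu), h3.trans hw⟩

theorem union {Y Z : Set V} {w w' : ℕ} (h : BroadcastCovers G k Y w)
    (h' : BroadcastCovers G k Z w') : BroadcastCovers G k (Y ∪ Z) (w + w') := by
  obtain ⟨f, h1, h2, h3⟩ := h
  obtain ⟨g, g1, g2, g3⟩ := h'
  refine ⟨fun v => max (f v) (g v), fun v => max_le (h1 v) (g1 v), ?_, ?_⟩
  · rintro u (hu | hu)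
    · obtain ⟨v, hv, hd⟩ := h2 u hu
      exact ⟨v, le_max_of_le_left hv, le_max_of_le_left hd⟩
    · obtain ⟨v, hv, hd⟩ := g2 u hu
      exact ⟨v, le_max_of_le_right hv, le_max_of_le_right hd⟩
  · calc ∑ v, max (f v) (g v) ≤ ∑ v, (f v + g v) :=
          Finset.sum_le_sum fun v _ => by omega
      _ = ∑ v, f v + ∑ v, g v := Finset.sum_add_distrib
      _ ≤ w + w' := by omega

theorem of_ball {Y : Set V} {c : V} {r : ℕ} (h1 : 1 ≤ r) (hk : r ≤ k)
    (hY : ∀ u ∈ Y, G.dist c u ≤ r) : BroadcastCovers G k Y r := by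
  classical
  refine ⟨fun v => if v = c then r else 0, fun v => ?_, fun u hu => ⟨c, ?_, ?_⟩, ?_⟩
  · dsimp only; split_ifs <;> omega
  · simpa using h1
  · simpa [SimpleGraph.dist_comm] using hY u hu
  · simp

theorem of_diam {x : GraftTree V} (hG : G.Connected) (hx : x.Valid G) {r : ℕ} (h1 : 1 ≤ r)
    (hk : r ≤ k) (hd : x.diam ≤ 2 * r) : BroadcastCovers G k x.verts r := by
  obtain ⟨c, _, hc⟩ := GraftTree.exists_center hG hx hd
  exact of_ball h1 hk hc

end BroadcastCovers

open GraftTree in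
/-- A tree from which no part can be cut off and dominated at a cost within the bound, and which
cannot be dominated as a whole within the bound. -/
structure Uncuttable {V : Type*} [Fintype V] (G : SimpleGraph V) (k : ℕ)
    (x : GraftTree V) : Prop where
  valid : x.Valid G
  cut : ∀ (z z' : GraftTree V) (Y : Set V) (w : ℕ), Subterm z x → z'.Valid G →
    z'.root = z.root → z'.size < z.size → z.verts ⊆ z'.verts ∪ Y → BroadcastCovers G k Y w →
    (k + 2) * z.size < 3 * (k + 1) * w + (k + 2) * z'.size
  whole : ∀ w, BroadcastCovers G k x.verts w →
    (k + 2) * x.size + 3 * (k + 1) ≤ 3 * (k + 1) * w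

namespace GraftTree

variable {V : Type*}

/-- `y` is the set of all descendants of one of its vertices in `x`. -/
def IsBranch (y x : GraftTree V) : Prop := y = x ∨ ∃ t, Subterm (graft t y) x

theorem isBranch_right {t s x : GraftTree V} (hz : Subterm (graft t s) x) : IsBranch s x :=
  Or.inr ⟨t, hz⟩

theorem IsBranch.subterm {y x : GraftTree V} (h : IsBranch y x) : Subterm y x := by
  rcases h with rfl | ⟨t, h⟩
  · exact .refl
  · exact Subterm.trans (Subterm.right .refl) h

end GraftTree

namespace Uncuttable

open GraftTree

variable {V : Type*} [Fintype V] {G : SimpleGraph V} {k : ℕ} {x : GraftTree V}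

theorem branch_cost (hx : Uncuttable G k x) {y : GraftTree V} (hy : IsBranch y x) {w : ℕ}
    (hw : BroadcastCovers G k y.verts w) : (k + 2) * y.size < 3 * (k + 1) * w := by
  rcases hy with rfl | ⟨t, h⟩
  · have := hx.whole w hw
    omega
  · have := hx.cut (graft t y) t y.verts w h (h.valid hx.valid).1 rfl
      (by have := y.size_pos; simp only [size]; omega) subset_rfl hw
    simp only [size] at this
    rw [mul_add] at this
    omega

theorem size_lt (hG : G.Connected) (hx : Uncuttable G k x) {y : GraftTree V}
    (hy : IsBranch y x) {r : ℕ} (h1 : 1 ≤ r) (hk : r ≤ k) (hd : y.diam ≤ 2 * r) :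
    y.size < 3 * r := by
  have h := hx.branch_cost hy (.of_diam hG (hy.subterm.valid hx.valid) h1 hk hd)
  by_contra! hc
  nlinarith

theorem size_add_two_le (hG : G.Connected) (hx : Uncuttable G k x) {y : GraftTree V}
    (hy : IsBranch y x) {r : ℕ} (h1 : 1 ≤ r) (hk : r ≤ k) (hd : y.diam ≤ 2 * r)
    (hs : k + 1 ≤ y.size) : y.size + 2 ≤ 3 * r := by
  have h := hx.branch_cost hy (.of_diam hG (hy.subterm.valid hx.valid) h1 hk hd)
  by_contra! hc
  have : 3 * r ≤ y.size + 1 := by omega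
  nlinarith

/-- The lower bounds on the order of a subterm in terms of its diameter and height. -/
theorem size_bounds (hG : G.Connected) (hx : Uncuttable G k x) {z : GraftTree V}
    (hz : Subterm z x) (hd : z.diam ≤ 2 * k) :
    3 * z.diam ≤ 2 * z.size + 2 ∧ (z.diam = z.height → 3 * z.diam ≤ 2 * z.size) ∧
      (IsBranch z x → 3 * z.height + 1 ≤ 2 * z.size) := by
  have last : ∀ y : GraftTree V, y.diam ≤ 2 * k → 3 * y.diam ≤ 2 * y.size + 2 →
      (y.diam = y.height → 3 * y.diam ≤ 2 * y.size) →
      IsBranch y x → 3 * y.height + 1 ≤ 2 * y.size := by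
    intro y hy h1 h2 hb
    have h3 := y.height_le_diam
    have h4 := y.size_pos
    by_contra! hc
    have h5 : y.diam = y.height := by omega
    have h6 := h2 h5
    have h7 := hx.size_lt hG hb (r := y.height / 2) (by omega) (by omega) (by omega)
    omega
  suffices h : 3 * z.diam ≤ 2 * z.size + 2 ∧
      (z.diam = z.height → 3 * z.diam ≤ 2 * z.size) from
    ⟨h.1, h.2, last z hd h.1 h.2⟩
  induction z with
  | single v => simp [diam]
  | graft t s iht ihs =>
    have ht : Subterm t x := (Subterm.left .refl).trans hz
    have hs : Subterm s x := (Subterm.right .refl).trans hz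
    have e1 := t.height_le_diam
    have e2 := s.height_le_diam
    have e3 := t.height_lt_size
    simp only [diam] at hd
    obtain ⟨t1, t2⟩ := iht ht (by omega)
    obtain ⟨s1, s2⟩ := ihs hs (by omega)
    have s3 := last s (by omega) s1 s2 (isBranch_right hz)
    have t3 : 3 * t.height ≤ 2 * t.size := by
      by_cases h : t.diam = t.height
      · have := t2 h; omega
      · omega
    simp only [diam, height, size]
    omega

theorem three_mul_height_le (hG : G.Connected) (hx : Uncuttable G k x) {z : GraftTree V}
    (hz : Subterm z x) (hd : z.diam ≤ 2 * k) : 3 * z.height ≤ 2 * z.size := by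
  obtain ⟨h1, h2, -⟩ := hx.size_bounds hG hz hd
  have := z.height_le_diam
  by_cases h : z.diam = z.height
  · have := h2 h; omega
  · omega

theorem two_mul_lt_diam (hG : G.Connected) (hk : 1 ≤ k) (hx : Uncuttable G k x) :
    2 * k < x.diam := by
  by_contra! hd
  obtain ⟨h1, -, -⟩ := hx.size_bounds hG .refl hd
  have h2 := x.size_pos
  obtain ⟨r, hr1, hrk, hr2, hr3⟩ : ∃ r, 1 ≤ r ∧ r ≤ k ∧ x.diam ≤ 2 * r ∧ 3 * r ≤ x.size + 2 :=
    ⟨max 1 ((x.diam + 1) / 2), by omega, by omega, by omega, by omega⟩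
  have h3 := hx.whole r (.of_diam hG hx.valid hr1 hrk hr2)
  nlinarith

/-- The deepest level of a subterm of minimal order is dominated by a single vertex. -/
theorem covers_deepest_level (hG : G.Connected) (hk : 1 ≤ k) (hx : Uncuttable G k x)
    {z : GraftTree V} (hz : Subterm z x) (hd : z.diam ≤ 2 * k) (hh : 1 ≤ z.height)
    (hs : 2 * z.size ≤ 3 * z.height + 2) :
    BroadcastCovers G k (z.level z.height) 1 := by
  induction z with
  | single v => simp [height] at hh
  | graft t s iht ihs =>
    by_cases h1 : (graft t s).height = 1
    · refine .of_ball (c := (graft t s).root) le_rfl hk fun u hu => ?_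
      rw [h1] at hu
      exact dist_root_le_of_mem_level hG (hz.valid hx.valid) hu
    have ht : Subterm t x := (Subterm.left .refl).trans hz
    have hs' : Subterm s x := (Subterm.right .refl).trans hz
    have hbd := (hx.size_bounds hG hz hd).1
    have e1 := t.size_pos
    have e2 := s.size_pos
    have e3 := t.height_lt_size
    simp only [diam] at hd
    have t1 := hx.three_mul_height_le hG ht (by omega)
    obtain ⟨s1, -, s2⟩ := hx.size_bounds hG hs' (by omega)
    have s3 := s2 (isBranch_right hz)
    rcases lt_trichotomy t.height (s.height + 1) with h | h | h
    · rw [level_graft_of_lt_right h]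
      simp only [height, size, diam] at hs h1 hbd
      refine ihs hs' (by omega) (by omega) ?_
      by_contra! hc
      have := hx.size_lt hG (isBranch_right hz) (r := (s.height + 1) / 2) (by omega) (by
        have := s.height_le_diam; omega) (by omega)
      omega
    · simp only [height, size] at hs h1
      omega
    · rw [level_graft_of_lt_left h]
      simp only [height, size] at hs
      exact iht ht (by omega) (by omega) (by omega)

/-- A branch of height at least `k` and bounded diameter splits at its root into two parts of
minimal order. -/
theorem exists_eq_graft (hG : G.Connected) (hk : 3 ≤ k) (hx : Uncuttable G k x)
    {a : GraftTree V} (ha : IsBranch a x) (hd : a.diam ≤ 2 * k) (hh : k ≤ a.height) :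
    2 * a.size + 1 = 3 * a.diam ∧ ∃ t s, a = graft t s ∧ a.diam = t.height + s.height + 1 ∧
      2 * t.size ≤ 3 * t.height + 1 ∧ 2 * s.size ≤ 3 * s.height + 2 := by
  have h1 := (hx.size_bounds hG ha.subterm hd).1
  have h2 := a.height_le_diam
  have h3 := a.height_lt_size
  have h4 := hx.size_add_two_le hG ha (r := (a.diam + 1) / 2) (by omega) (by omega) (by omega)
    (by omega)
  have h5 : 2 * a.size + 1 = 3 * a.diam := by omega
  refine ⟨h5, ?_⟩
  cases a with
  | single v => simp [height] at hh; omega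
  | graft t s =>
    have ht : Subterm t x := (Subterm.left .refl).trans ha.subterm
    have hs : Subterm s x := (Subterm.right .refl).trans ha.subterm
    have e1 := t.size_pos
    have e2 := s.size_pos
    simp only [diam] at hd
    have t1 := (hx.size_bounds hG ht (by omega)).1
    have t2 := hx.three_mul_height_le hG ht (by omega)
    obtain ⟨s1, -, s2⟩ := hx.size_bounds hG hs (by omega)
    have s3 := s2 (isBranch_right ha.subterm)
    refine ⟨t, s, rfl, ?_⟩
    simp only [diam, size] at h5 ⊢
    omega

/-- No branch of even height at least `k` has bounded diameter. -/
theorem odd_height (hG : G.Connected) (hk : 3 ≤ k) (hx : Uncuttable G k x)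
    {a : GraftTree V} (ha : IsBranch a x) (hd : a.diam ≤ 2 * k) (hh : k ≤ a.height) :
    a.height % 2 = 1 := by
  by_contra hodd
  obtain ⟨-, t, s, rfl, h1, h2, h3⟩ := hx.exists_eq_graft hG hk ha hd hh
  have hle := (graft t s).height_le_diam
  obtain ⟨b, hb, hbh, hbs, hbd⟩ : ∃ b, IsBranch b x ∧ b.height + 1 = (graft t s).height ∧
      2 * b.size ≤ 3 * b.height + 2 ∧ b.diam ≤ (graft t s).diam := by
    by_cases hts : t.height ≤ s.height
    · exact ⟨s, isBranch_right ha.subterm, by simp only [height]; omega, h3,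
        (Subterm.right .refl).diam_le⟩
    · obtain ⟨q, b, t', hq, hb, -, -, -, hsz, -⟩ :=
        exists_child (ha.subterm.valid hx.valid).1 (by omega)
      have e := t'.size_pos
      exact ⟨b, isBranch_right (hq.trans ((Subterm.left .refl).trans ha.subterm)),
        by simp only [height]; omega, by omega,
        ((Subterm.right .refl).trans (hq.trans (Subterm.left .refl))).diam_le⟩
  obtain ⟨b1, -, b2⟩ := hx.size_bounds hG hb.subterm (by omega)
  have b3 := b2 hb
  have := hx.size_add_two_le hG hb (r := (b.height + 1) / 2) (by omega) (by omega) (by omega)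
    (by omega)
  omega

theorem height_le (hG : G.Connected) (hk : 3 ≤ k) (hx : Uncuttable G k x)
    {a : GraftTree V} (ha : IsBranch a x) (hd : a.diam ≤ 2 * k) : a.height ≤ k := by
  by_contra! hh
  have h1 := hx.odd_height hG hk ha hd hh.le
  obtain ⟨q, b, -, hq, hb, -⟩ := exists_child (ha.subterm.valid hx.valid) (by omega)
  have h2 := hx.odd_height hG hk (isBranch_right (hq.trans ha.subterm))
    (((Subterm.right .refl).trans hq).diam_le.trans hd) (by omega)
  omega

theorem size_and_covers_of_height_eq (hG : G.Connected) (hk : 3 ≤ k) (hx : Uncuttable G k x)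
    {a : GraftTree V} (ha : IsBranch a x) (hd : a.diam ≤ 2 * k) (hh : a.height = k) :
    3 * k + 5 ≤ 2 * a.size ∧ BroadcastCovers G k (a.level k) 1 := by
  have hodd := hx.odd_height hG hk ha hd hh.ge
  obtain ⟨h0, t, s, rfl, h1, h2, h3⟩ := hx.exists_eq_graft hG hk ha hd hh.ge
  have hle := (graft t s).height_le_diam
  have hB := (hx.size_bounds hG ha.subterm hd).2.1
  have hne : (graft t s).diam ≠ (graft t s).height := fun h => by
    have := hB h
    omega
  refine ⟨by omega, ?_⟩
  have ht : Subterm t x := (Subterm.left .refl).trans ha.subterm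
  have hs : Subterm s x := (Subterm.right .refl).trans ha.subterm
  have dt : t.diam ≤ (graft t s).diam := (Subterm.left .refl).diam_le
  have ds : s.diam ≤ (graft t s).diam := (Subterm.right .refl).diam_le
  have hmax : (graft t s).height = max t.height (s.height + 1) := rfl
  suffices h : BroadcastCovers G k ((graft t s).level (graft t s).height) 1 by
    rw [hh] at h
    exact h
  rcases lt_trichotomy t.height (s.height + 1) with h | h | h
  · rw [level_graft_of_lt_right h]
    exact hx.covers_deepest_level hG (by omega) hs (by omega) (by omega) h3
  · omega
  · rw [level_graft_of_lt_left h]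
    exact hx.covers_deepest_level hG (by omega) ht (by omega) (by omega) (by omega)

/-- A branch whose root is adjacent to `c` is dominated by a ball of radius `k` around `c`,
up to its vertices at depth `k`. -/
theorem branch_covers (hG : G.Connected) (hk : 3 ≤ k) (hx : Uncuttable G k x)
    {a : GraftTree V} (ha : IsBranch a x) (hd : a.diam ≤ 2 * k) {c : V}
    (hc : G.Adj c a.root) :
    a.height < k ∧ (∀ u ∈ a.verts, G.dist c u ≤ k) ∨
      a.height = k ∧ k % 2 = 1 ∧ 3 * k + 5 ≤ 2 * a.size ∧
        ∃ Y, BroadcastCovers G k Y 1 ∧ ∀ u ∈ a.verts, u ∈ Y ∨ G.dist c u ≤ k := by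
  have hv := ha.subterm.valid hx.valid
  have h1 := SimpleGraph.dist_eq_one_iff_adj.2 hc
  rcases (hx.height_le hG hk ha hd).lt_or_eq with h | h
  · refine Or.inl ⟨h, fun u hu => ?_⟩
    have h2 := dist_root_le_height hG hv hu
    have h3 := hG.dist_triangle (u := c) (v := a.root) (w := u)
    omega
  · obtain ⟨h2, h3⟩ := hx.size_and_covers_of_height_eq hG hk ha hd h
    refine Or.inr ⟨h, h ▸ hx.odd_height hG hk ha hd h.ge, h2, _, h3, fun u hu => ?_⟩
    obtain ⟨d, hdk, hu⟩ := exists_mem_level_of_mem_verts hu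
    rcases (hdk.trans h.le).lt_or_eq with hlt | rfl
    · have h4 := dist_root_le_of_mem_level hG hv hu
      have h5 := hG.dist_triangle (u := c) (v := a.root) (w := u)
      exact Or.inr (by omega)
    · exact Or.inl hu

theorem subterm_diam_le (hG : G.Connected) (hk : 3 ≤ k) (hx : Uncuttable G k x)
    {z : GraftTree V} (hz : Subterm z x) : z.diam ≤ 2 * k := by
  induction z with
  | single v => simp [diam]
  | graft t s iht ihs =>
    by_contra! hd
    have htx : Subterm t x := (Subterm.left .refl).trans hz
    have ht := iht htx
    have hs := ihs ((Subterm.right .refl).trans hz)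
    have hv := hz.valid hx.valid
    have hsB := isBranch_right hz
    have hsk := hx.height_le hG hk hsB hs
    simp only [diam] at hd
    obtain ⟨q, b, t', hq, hbh, hadj, hv', hr', hsz, hsub⟩ :=
      exists_child hv.1 (by have := t.height_le_diam; omega)
    have hbB := isBranch_right (hq.trans htx)
    have hb : b.diam ≤ 2 * k := (((Subterm.right .refl).trans hq).diam_le).trans ht
    have hbs := ((hx.size_bounds hG hbB.subterm hb).2.2) hbB
    have hss := ((hx.size_bounds hG hsB.subterm hs).2.2) hsB
    have key : ∀ Y w, BroadcastCovers G k Y w →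
        (∀ u ∈ b.verts ∪ s.verts, u ∈ Y ∨ G.dist t.root u ≤ k) →
        (k + 2) * (b.size + s.size) < 3 * (k + 1) * (w + k) := by
      intro Y w hY hc
      have hball : BroadcastCovers G k {u | G.dist t.root u ≤ k} k :=
        .of_ball (by omega) le_rfl fun u hu => hu
      have := hx.cut (graft t s) t' (Y ∪ {u | G.dist t.root u ≤ k}) (w + k) hz hv' hr'
        (by have := s.size_pos; simp only [size]; omega)
        (by
          rintro u (hu | hu)
          · exact (hsub hu).imp id fun h => hc u (Or.inl h)
          · exact Or.inr (hc u (Or.inr hu)))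
        (hY.union hball)
      simp only [size, ← hsz] at this
      nlinarith
    rcases hx.branch_covers hG hk hbB hb hadj with ⟨b1, b2⟩ | ⟨b1, b3, b4, Y, b5, b6⟩ <;>
    rcases hx.branch_covers hG hk hsB hs hv.2.2 with ⟨s1, s2⟩ | ⟨s1, s3, s4, Z, s5, s6⟩
    · omega
    · have := key Z 1 s5 (by
        rintro u (hu | hu)
        exacts [Or.inr (b2 u hu), s6 u hu])
      have : 3 * k + 2 ≤ b.size + s.size := by omega
      nlinarith
    · have := key Y 1 b5 (by
        rintro u (hu | hu)
        exacts [b6 u hu, Or.inr (s2 u hu)])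
      have : 3 * k + 2 ≤ b.size + s.size := by omega
      nlinarith
    · have := key (Y ∪ Z) 2 (b5.union s5) (by
        rintro u (hu | hu)
        exacts [(b6 u hu).imp_left Or.inl, (s6 u hu).imp_left Or.inr])
      have : 3 * k + 5 ≤ b.size + s.size := by omega
      nlinarith

end Uncuttable

/-- Every tree of order `n` in `G` is dominated at cost less than `(k+2)n/(3(k+1)) + 1`. -/
theorem GraftTree.Valid.exists_broadcastCovers {V : Type*} [Fintype V] {G : SimpleGraph V}
    (hG : G.Connected) {k : ℕ} (hk : 3 ≤ k) {x : GraftTree V} (hx : x.Valid G) :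
    ∃ w, BroadcastCovers G k x.verts w ∧
      3 * (k + 1) * w < (k + 2) * x.size + 3 * (k + 1) := by
  induction hn : x.size using Nat.strong_induction_on generalizing x with
  | _ n ih =>
    subst hn
    by_contra! hno
    have hunc : Uncuttable G k x := by
      refine ⟨hx, fun z z' Y w hz hz' hr hlt hsub hY => ?_, hno⟩
      obtain ⟨x', h1, -, h2, h3⟩ := hz.replace hx hz' hr hsub
      obtain ⟨w', h4, h5⟩ := ih x'.size (by omega) h1 rfl
      have h6 := hno (w' + w) ((h4.union hY).mono h3 le_rfl)
      nlinarith
    have h1 := hunc.two_mul_lt_diam hG (by omega)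
    have h2 := hunc.subterm_diam_le hG hk .refl
    omega

theorem gammaBk_upper_bound {V : Type*} [Fintype V] (G : SimpleGraph V)
    (hG : G.Connected) (k : ℕ) (hk : 3 ≤ k) :
    (gammaBk G k : ℤ) ≤
      ⌈((k : ℚ) + 2) / ((k : ℚ) + 1) * ((Fintype.card V : ℚ) / 3)⌉ := by
  obtain ⟨x, hx, hcard, huniv⟩ := GraftTree.exists_spanning hG
  obtain ⟨w, ⟨f, hf, hdom, hsum⟩, hw⟩ := hx.exists_broadcastCovers hG hk
  have hle : gammaBk G k ≤ w := by
    have hdomf : IsDomKBroadcast G k f := by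
      refine ⟨hf, fun u => ?_⟩
      obtain ⟨v, h1, h2⟩ := hdom u (huniv ▸ Set.mem_univ u)
      exact ⟨v, h1, hG.preconnected u v, h2⟩
    have hmem : gammaBk G k ≤ ∑ v, f v := Nat.sInf_le ⟨f, hdomf, finsum_eq_sum_of_fintype f⟩
    exact hmem.trans hsum
  refine (Int.ofNat_le.2 hle).trans (Int.le_ceil_iff.2 ?_)
  rw [hcard] at hw
  have hw' : 3 * ((k : ℚ) + 1) * w < (k + 2) * Fintype.card V + 3 * (k + 1) := by
    exact_mod_cast hw
  have hpos : (0 : ℚ) < 3 * (k + 1) := by positivity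
  rw [div_mul_div_comm, lt_div_iff₀ (by positivity)]
  push_cast
  linarith
end
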